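/- Fix 0 < ε ≤ 1/3. There exist constants C > 0 and λ₀ > 0, depending only on ε, such that for every λ ≥ λ₀ and every family of complex numbers b = (b_z)_{z ∈ Z_λ}, one has Σ |b_z||b_w| / |z−w|₊^{1/2} ≤ C·B_λ·Σ_{z∈Z_λ} |b_z|², where the sum on the left is over all pairs z, w ∈ Z_λ with 0 < Δ(z) ≤ √λ, 0 < Δ(w) ≤ √λ and |z − w| < λ^ε. -/

import Mathlib

open MeasureTheory Real

noncomputable section

/-- The Euclidean norm of a vector in `ℝ × ℝ`. -/
def e2 (x : ℝ × ℝ) : ℝ := Real.sqrt (x.1 ^ 2 + x.2 ^ 2)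

/-- The integer vector `μ` viewed as a vector in `ℝ × ℝ`. -/
def iv (μ : ℤ × ℤ) : ℝ × ℝ := ((μ.1 : ℝ), (μ.2 : ℝ))

/-- The set of lattice points on the circle of radius `lam`. -/
def Elat (lam : ℝ) : Finset (ℤ × ℤ) := by
  classical
  exact (Finset.Icc (-⌈lam⌉, -⌈lam⌉) (⌈lam⌉, ⌈lam⌉)).filter
    (fun μ => (μ.1 : ℝ) ^ 2 + (μ.2 : ℝ) ^ 2 = lam ^ 2)

/-- `B_lam`: the maximal number of lattice points on the circle of radius `lam`
lying in an arc of length `√lam`. -/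
def Bmax (lam : ℝ) : ℕ := by
  classical
  exact sSup {n : ℕ | ∃ x : ℝ × ℝ, e2 x = lam ∧
    n = ((Elat lam).filter fun ξ => e2 (iv ξ - x) ≤ Real.sqrt lam).card}

/-- `Z_lam`: the set of medians `(μ+ν)/2` of pairs of lattice points on the circle
of radius `lam`. -/
def Zmed (lam : ℝ) : Finset (ℝ × ℝ) := by
  classical
  exact ((Elat lam) ×ˢ (Elat lam)).image fun p => ((1:ℝ)/2) • (iv p.1 + iv p.2)

/-- `Δ(z) = √(lam² - |z|²)`, half the distance between the two points of the circle of
radius `lam` with midpoint `z`. -/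
def Del (lam : ℝ) (z : ℝ × ℝ) : ℝ := Real.sqrt (lam ^ 2 - (e2 z) ^ 2)

/-- Rotation of a plane vector by `π/2`. -/
def perp (z : ℝ × ℝ) : ℝ × ℝ := (-z.2, z.1)

/-- `μ₊(z) = z + Δ(z)·z^⊥/|z^⊥|`, one of the two points on the circle of radius `lam`
whose midpoint is `z`. -/
def mup (lam : ℝ) (z : ℝ × ℝ) : ℝ × ℝ := z + (Del lam z / e2 z) • perp z

/-- The bilinear sum `∑ |b_z||b_w| / |z-w|₊^{1/2}` over pairs `z, w ∈ Z_lam` satisfying the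
predicate `P` and `|z - w| < lam^ε`, where `|x|₊ = max(1,|x|)`. -/
def pairSum (lam ε : ℝ) (P : ℝ × ℝ → Prop) (b : ℝ × ℝ → ℂ) : ℝ := by
  classical
  exact ∑ p ∈ ((Zmed lam) ×ˢ (Zmed lam)).filter
      (fun p => P p.1 ∧ P p.2 ∧ e2 (p.1 - p.2) < lam ^ ε),
    ‖b p.1‖ * ‖b p.2‖ / Real.sqrt (max 1 (e2 (p.1 - p.2)))

/-- Points in a square of half-side `K * d`, at most `N` of which lie in any set of diameter
at most `d`, number at most `(4 * K + 1) ^ 2 * N`. -/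
lemma card_le_of_card_le_of_small_diam {S : Finset (ℤ × ℤ)} {c : ℝ × ℝ} {d : ℝ} (hd : 0 < d)
    (K N : ℕ) (h₁ : ∀ x ∈ S, |(x.1 : ℝ) - c.1| ≤ K * d) (h₂ : ∀ x ∈ S, |(x.2 : ℝ) - c.2| ≤ K * d)
    (hN : ∀ T ⊆ S, (∀ x ∈ T, ∀ y ∈ T,
      ((x.1 : ℝ) - y.1) ^ 2 + ((x.2 : ℝ) - y.2) ^ 2 ≤ d ^ 2) → T.card ≤ N) :
    S.card ≤ (4 * K + 1) ^ 2 * N := by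
  classical
  have floor_mem (t : ℝ) (ht : |t| ≤ K * d) :
      ⌊2 * t / d⌋ ∈ Finset.Icc (-(2 * K : ℤ)) (2 * K) := by
    obtain ⟨hl, hu⟩ := abs_le.mp ht
    rw [Finset.mem_Icc, Int.le_floor]
    refine ⟨?_, Int.floor_le_iff.mpr ?_⟩
    · rw [le_div_iff₀ hd]; push_cast; linarith
    · rw [div_lt_iff₀ hd]; push_cast; linarith
  have sq_le (s t : ℝ) (hst : ⌊2 * s / d⌋ = ⌊2 * t / d⌋) : (s - t) ^ 2 ≤ (d / 2) ^ 2 := by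
    have h := Int.abs_sub_lt_one_of_floor_eq_floor hst
    rw [← sub_div, ← mul_sub, abs_div, abs_of_pos hd, div_lt_one hd, abs_mul, abs_two] at h
    exact sq_le_sq' (by linarith [neg_abs_le (s - t)]) (by linarith [le_abs_self (s - t)])
  let f : ℤ × ℤ → ℤ × ℤ := fun x =>
    (⌊2 * ((x.1 : ℝ) - c.1) / d⌋, ⌊2 * ((x.2 : ℝ) - c.2) / d⌋)
  have hcard := Finset.card_le_mul_card_image_of_maps_to (f := f) (s := S)
    (t := Finset.Icc (-(2 * K : ℤ)) (2 * K) ×ˢ Finset.Icc (-(2 * K : ℤ)) (2 * K))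
    (fun x hx => Finset.mem_product.mpr
      ⟨floor_mem _ (h₁ x hx), floor_mem _ (h₂ x hx)⟩) N
    (fun p _ => hN _ (Finset.filter_subset _ _) fun x hx y hy => by
      have hxy : f x = f y :=
        (Finset.mem_filter.mp hx).2.trans (Finset.mem_filter.mp hy).2.symm
      have e₁ := sq_le _ _ (congrArg Prod.fst hxy)
      have e₂ := sq_le _ _ (congrArg Prod.snd hxy)
      rw [sub_sub_sub_cancel_right] at e₁ e₂
      nlinarith [sq_nonneg d])
  have hK : ((2 * K : ℤ) + 1 - -(2 * K)).toNat = 4 * K + 1 := by omega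
  rw [Finset.card_product, Int.card_Icc, hK] at hcard
  linarith

lemma sq_add_sq_of_mem_Elat {lam : ℝ} {μ : ℤ × ℤ} (h : μ ∈ Elat lam) :
    (μ.1 : ℝ) ^ 2 + (μ.2 : ℝ) ^ 2 = lam ^ 2 := by
  unfold Elat at h
  exact (Finset.mem_filter.mp h).2

/-- If `a`, `b`, `c` lie on a circle of radius `lam`, the product of the squared sides of
the triangle they form is `16 * lam ^ 2` times its squared area. -/
lemma prod_sq_sides_eq {lam a₁ a₂ b₁ b₂ c₁ c₂ : ℝ} (ha : a₁ ^ 2 + a₂ ^ 2 = lam ^ 2)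
    (hb : b₁ ^ 2 + b₂ ^ 2 = lam ^ 2) (hc : c₁ ^ 2 + c₂ ^ 2 = lam ^ 2) :
    ((a₁ - b₁) ^ 2 + (a₂ - b₂) ^ 2) * ((a₁ - c₁) ^ 2 + (a₂ - c₂) ^ 2) *
        ((b₁ - c₁) ^ 2 + (b₂ - c₂) ^ 2) =
      4 * lam ^ 2 * ((b₁ - a₁) * (c₂ - a₂) - (b₂ - a₂) * (c₁ - a₁)) ^ 2 := by
  obtain ⟨u₁, rfl⟩ : ∃ u, b₁ = a₁ + u := ⟨b₁ - a₁, by ring⟩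
  obtain ⟨u₂, rfl⟩ : ∃ u, b₂ = a₂ + u := ⟨b₂ - a₂, by ring⟩
  obtain ⟨v₁, rfl⟩ : ∃ v, c₁ = a₁ + v := ⟨c₁ - a₁, by ring⟩
  obtain ⟨v₂, rfl⟩ : ∃ v, c₂ = a₂ + v := ⟨c₂ - a₂, by ring⟩
  have hu : u₁ ^ 2 + u₂ ^ 2 = -2 * (a₁ * u₁ + a₂ * u₂) := by linarith
  have hv : v₁ ^ 2 + v₂ ^ 2 = -2 * (a₁ * v₁ + a₂ * v₂) := by linarith
  have h₁ : 2 * (u₁ * v₂ - u₂ * v₁) * a₁ =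
      (v₁ ^ 2 + v₂ ^ 2) * u₂ - (u₁ ^ 2 + u₂ ^ 2) * v₂ := by rw [hu, hv]; ring
  have h₂ : 2 * (u₁ * v₂ - u₂ * v₁) * a₂ =
      (u₁ ^ 2 + u₂ ^ 2) * v₁ - (v₁ ^ 2 + v₂ ^ 2) * u₁ := by rw [hu, hv]; ring
  calc _ = ((v₁ ^ 2 + v₂ ^ 2) * u₂ - (u₁ ^ 2 + u₂ ^ 2) * v₂) ^ 2 +
        ((u₁ ^ 2 + u₂ ^ 2) * v₁ - (v₁ ^ 2 + v₂ ^ 2) * u₁) ^ 2 := by ring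
    _ = _ := by rw [← h₁, ← h₂, ← ha]; ring

lemma sq_add_sq_sub_pos {x y : ℤ × ℤ} (h : x ≠ y) :
    0 < ((x.1 : ℝ) - y.1) ^ 2 + ((x.2 : ℝ) - y.2) ^ 2 := by
  by_contra! hle
  have h₁ : ((x.1 : ℝ) - y.1) ^ 2 = 0 := by
    linarith [sq_nonneg ((x.1 : ℝ) - y.1), sq_nonneg ((x.2 : ℝ) - y.2)]
  have h₂ : ((x.2 : ℝ) - y.2) ^ 2 = 0 := by
    linarith [sq_nonneg ((x.1 : ℝ) - y.1), sq_nonneg ((x.2 : ℝ) - y.2)]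
  refine h (Prod.ext ?_ ?_)
  · exact_mod_cast sub_eq_zero.mp (pow_eq_zero_iff two_ne_zero |>.mp h₁)
  · exact_mod_cast sub_eq_zero.mp (pow_eq_zero_iff two_ne_zero |>.mp h₂)

/-- A set of lattice points on the circle of radius `lam` whose diameter `d` satisfies
`d ^ 3 ≤ lam` has at most two elements. -/
lemma card_le_two_of_small_diam {lam d : ℝ} (hd : 0 < d) (hdl : d ^ 3 ≤ lam)
    {T : Finset (ℤ × ℤ)} (hT : T ⊆ Elat lam) (hdiam : ∀ x ∈ T, ∀ y ∈ T,
      ((x.1 : ℝ) - y.1) ^ 2 + ((x.2 : ℝ) - y.2) ^ 2 ≤ d ^ 2) : T.card ≤ 2 := by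
  by_contra! hcard
  obtain ⟨a, b, c, ha, hb, hc, hab, hac, hbc⟩ := Finset.two_lt_card_iff.mp hcard
  have key := prod_sq_sides_eq (sq_add_sq_of_mem_Elat (hT ha)) (sq_add_sq_of_mem_Elat (hT hb))
    (sq_add_sq_of_mem_Elat (hT hc))
  have pab := sq_add_sq_sub_pos hab
  have pac := sq_add_sq_sub_pos hac
  have pbc := sq_add_sq_sub_pos hbc
  have hle := mul_le_mul (mul_le_mul (hdiam a ha b hb) (hdiam a ha c hc) pac.le (sq_nonneg d))
    (hdiam b hb c hc) pbc.le (by positivity)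
  have hpos := mul_pos (mul_pos pab pac) pbc
  rw [key] at hle hpos
  have hD : (b.1 - a.1) * (c.2 - a.2) - (b.2 - a.2) * (c.1 - a.1) ≠ 0 := by
    intro h
    have h' : ((b.1 : ℝ) - a.1) * (c.2 - a.2) - (b.2 - a.2) * (c.1 - a.1) = 0 := by
      exact_mod_cast h
    rw [h'] at hpos
    simp at hpos
  have hD1 : (1 : ℝ) ≤
      (((b.1 : ℝ) - a.1) * (c.2 - a.2) - (b.2 - a.2) * (c.1 - a.1)) ^ 2 := by
    exact_mod_cast Int.add_one_le_iff.mpr (sq_pos_of_ne_zero hD)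
  have h6 : (d ^ 3) ^ 2 ≤ lam ^ 2 := pow_le_pow_left₀ (by positivity) hdl 2
  nlinarith [pow_pos ((pow_pos hd 3).trans_le hdl) 2]

/-- A set of lattice points on the circle of radius `lam` of diameter at most `√lam` has at most
`Bmax lam` elements. -/
lemma card_le_Bmax {lam : ℝ} (hlam : 0 < lam) {T : Finset (ℤ × ℤ)} (hT : T ⊆ Elat lam)
    (hdiam : ∀ x ∈ T, ∀ y ∈ T,
      ((x.1 : ℝ) - y.1) ^ 2 + ((x.2 : ℝ) - y.2) ^ 2 ≤ √lam ^ 2) : T.card ≤ Bmax lam := by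
  classical
  obtain rfl | ⟨x, hx⟩ := T.eq_empty_or_nonempty
  · simp
  have hsub : T ⊆ (Elat lam).filter fun ξ => e2 (iv ξ - iv x) ≤ √lam := fun y hy =>
    Finset.mem_filter.mpr ⟨hT hy, Real.sqrt_le_left (Real.sqrt_nonneg _) |>.mpr
      (by simpa [iv] using hdiam y hy x hx)⟩
  refine (Finset.card_le_card hsub).trans ?_
  unfold Bmax
  refine le_csSup ⟨(Elat lam).card, ?_⟩ ⟨iv x, ?_, ?_⟩
  · rintro n ⟨y, -, rfl⟩
    exact Finset.card_le_card (Finset.filter_subset _ _)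
  · simp only [e2, iv, sq_add_sq_of_mem_Elat (hT hx), Real.sqrt_sq hlam.le]
  · congr!

lemma abs_fst_le_e2 (x : ℝ × ℝ) : |x.1| ≤ e2 x :=
  Real.abs_le_sqrt (by linarith [sq_nonneg x.2])

lemma abs_snd_le_e2 (x : ℝ × ℝ) : |x.2| ≤ e2 x :=
  Real.abs_le_sqrt (by linarith [sq_nonneg x.1])

/-- `Δ` of the midpoint of `μ, ν` is half the distance from `μ` to `ν`. -/
lemma Del_midpoint {lam : ℝ} {μ ν : ℤ × ℤ} (hμ : μ ∈ Elat lam) (hν : ν ∈ Elat lam) :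
    Del lam ((1 / 2 : ℝ) • (iv μ + iv ν)) = e2 ((1 / 2 : ℝ) • (iv μ - iv ν)) := by
  have h₁ := sq_add_sq_of_mem_Elat hμ
  have h₂ := sq_add_sq_of_mem_Elat hν
  unfold Del e2
  rw [Real.sq_sqrt (by positivity)]
  congr 1
  simp only [iv, Prod.smul_fst, Prod.smul_snd, Prod.fst_add, Prod.snd_add, Prod.fst_sub,
    Prod.snd_sub, smul_eq_mul]
  linarith

/-- The number of medians `w` with `Δ(w) ≤ √lam` in a ball of radius at most `lam ^ (1/3)`
is `O(Bmax lam)`. -/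
lemma card_medians_le {lam ρ : ℝ} (hlam : 1 ≤ lam) (hρ : ρ ≤ lam ^ (1 / 3 : ℝ)) (z : ℝ × ℝ)
    {W : Finset (ℝ × ℝ)} (hWZ : W ⊆ Zmed lam)
    (hW : ∀ w ∈ W, Del lam w ≤ √lam ∧ e2 (z - w) < ρ) :
    W.card ≤ 81 * Bmax lam * 162 := by
  classical
  have hpos : 0 < lam := by linarith
  set d := lam ^ (1 / 3 : ℝ) with hd_def
  have hd : 0 < d := Real.rpow_pos_of_pos hpos _
  have hd3 : d ^ 3 ≤ lam := by
    rw [hd_def, ← Real.rpow_natCast, ← Real.rpow_mul hpos.le]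
    norm_num
  have hds : d ≤ √lam := by
    rw [Real.sqrt_eq_rpow]
    exact Real.rpow_le_rpow_of_exponent_le hlam (by norm_num)
  set A := (Elat lam).filter fun μ =>
    |(μ.1 : ℝ) - z.1| ≤ 2 * √lam ∧ |(μ.2 : ℝ) - z.2| ≤ 2 * √lam
  let V : ℤ × ℤ → Finset (ℤ × ℤ) := fun μ => (Elat lam).filter fun ν =>
    |(ν.1 : ℝ) - (2 * z.1 - μ.1)| ≤ 2 * d ∧ |(ν.2 : ℝ) - (2 * z.2 - μ.2)| ≤ 2 * d
  have hA : A.card ≤ 81 * Bmax lam :=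
    card_le_of_card_le_of_small_diam (Real.sqrt_pos.mpr hpos) 2 _
      (fun x hx => (Finset.mem_filter.mp hx).2.1) (fun x hx => (Finset.mem_filter.mp hx).2.2)
      fun T hT => card_le_Bmax hpos (hT.trans (Finset.filter_subset _ _))
  have hV (μ : ℤ × ℤ) : (V μ).card ≤ 162 :=
    card_le_of_card_le_of_small_diam (c := (2 * z.1 - μ.1, 2 * z.2 - μ.2)) hd 2 2
      (fun x hx => (Finset.mem_filter.mp hx).2.1) (fun x hx => (Finset.mem_filter.mp hx).2.2)
      fun T hT => card_le_two_of_small_diam hd hd3 (hT.trans (Finset.filter_subset _ _))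
  have hsub : W ⊆ A.biUnion fun μ =>
      (V μ).image fun ν => (1 / 2 : ℝ) • (iv μ + iv ν) := by
    intro w hw
    obtain ⟨hΔ, hzw⟩ := hW w hw
    have hwZ := hWZ hw
    unfold Zmed at hwZ
    obtain ⟨⟨μ, ν⟩, hp, rfl⟩ := Finset.mem_image.mp hwZ
    obtain ⟨hμ, hν⟩ := Finset.mem_product.mp hp
    rw [Del_midpoint hμ hν] at hΔ
    have g₁ := abs_le.mp ((abs_fst_le_e2 _).trans hΔ)
    have g₂ := abs_le.mp ((abs_snd_le_e2 _).trans hΔ)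
    have k₁ := abs_le.mp ((abs_fst_le_e2 _).trans (hzw.le.trans hρ))
    have k₂ := abs_le.mp ((abs_snd_le_e2 _).trans (hzw.le.trans hρ))
    simp only [iv, Prod.smul_fst, Prod.smul_snd, Prod.fst_add, Prod.snd_add, Prod.fst_sub,
      Prod.snd_sub, smul_eq_mul] at g₁ g₂ k₁ k₂
    refine Finset.mem_biUnion.mpr ⟨μ, Finset.mem_filter.mpr ⟨hμ, ?_⟩,
      Finset.mem_image.mpr ⟨ν, Finset.mem_filter.mpr ⟨hν, ?_⟩, rfl⟩⟩
    · constructor <;> rw [abs_le] <;> constructor <;> linarith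
    · constructor <;> rw [abs_le] <;> constructor <;> linarith
  calc W.card ≤ _ := Finset.card_le_card hsub
    _ ≤ A.card * 162 :=
      Finset.card_biUnion_le_card_mul _ _ _ fun μ _ => Finset.card_image_le.trans (hV μ)
    _ ≤ _ := Nat.mul_le_mul_right _ hA

/-- Schur's test for the indicator of a symmetric relation with at most `M` neighbours per
point, applied to a kernel bounded by `1`. -/
lemma sum_filter_mul_le_of_card_le {α : Type*} (Z : Finset α) (R : α → α → Prop)
    [DecidablePred fun p : α × α => R p.1 p.2] [∀ z, DecidablePred (R z)]
    (hR : ∀ z w, R z w → R w z) (f : α → ℝ) (k : α × α → ℝ) (hf : ∀ z, 0 ≤ f z)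
    (hk : ∀ p, 1 ≤ k p) {M : ℝ} (hM : ∀ z, ((Z.filter (R z)).card : ℝ) ≤ M) :
    ∑ p ∈ (Z ×ˢ Z).filter (fun p => R p.1 p.2), f p.1 * f p.2 / k p ≤ M * ∑ z ∈ Z, f z ^ 2 := by
  have hfst : ∑ p ∈ (Z ×ˢ Z).filter (fun p => R p.1 p.2), f p.1 ^ 2 ≤ M * ∑ z ∈ Z, f z ^ 2 := by
    rw [Finset.sum_filter, Finset.sum_product, Finset.mul_sum]
    refine Finset.sum_le_sum fun z _ => ?_
    dsimp only
    rw [← Finset.sum_filter, Finset.sum_const, nsmul_eq_mul]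
    exact mul_le_mul_of_nonneg_right (hM z) (sq_nonneg _)
  have hsnd : ∑ p ∈ (Z ×ˢ Z).filter (fun p => R p.1 p.2), f p.2 ^ 2 =
      ∑ p ∈ (Z ×ˢ Z).filter (fun p => R p.1 p.2), f p.1 ^ 2 := by
    refine Finset.sum_equiv (Equiv.prodComm α α) (fun p => ?_) fun p _ => rfl
    simp only [Finset.mem_filter, Finset.mem_product, Equiv.prodComm_apply, Prod.fst_swap,
      Prod.snd_swap]
    exact ⟨fun h => ⟨h.1.symm, hR _ _ h.2⟩, fun h => ⟨h.1.symm, hR _ _ h.2⟩⟩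
  calc _ ≤ ∑ p ∈ (Z ×ˢ Z).filter (fun p => R p.1 p.2), (f p.1 ^ 2 + f p.2 ^ 2) / 2 := by
        refine Finset.sum_le_sum fun p _ => ?_
        have h := div_le_self (mul_nonneg (hf p.1) (hf p.2)) (hk p)
        linarith [two_mul_le_add_sq (f p.1) (f p.2)]
    _ ≤ _ := by
        rw [← Finset.sum_div, Finset.sum_add_distrib, hsnd]
        linarith

lemma e2_sub_comm (z w : ℝ × ℝ) : e2 (z - w) = e2 (w - z) := by
  simp only [e2, Prod.fst_sub, Prod.snd_sub, sub_sq_comm]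

/-- Proposition 7.1(i): the bilinear sum over pairs of medians with `0 < Δ ≤ √lam` which are
`lam^ε`-close is bounded by `O(B_lam) · ‖b‖²`. -/
theorem bilinear_schur_small_Delta
    (ε : ℝ) (hε0 : 0 < ε) (hε : ε ≤ 1/3) :
    ∃ C > (0:ℝ), ∃ lam0 > (0:ℝ), ∀ lam : ℝ, lam0 ≤ lam →
      ∀ b : ℝ × ℝ → ℂ,
        pairSum lam ε (fun z => 0 < Del lam z ∧ Del lam z ≤ Real.sqrt lam) b
          ≤ C * (Bmax lam : ℝ) * ∑ z ∈ Zmed lam, ‖b z‖ ^ 2 := by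
  classical
  refine ⟨81 * 162, by norm_num, 1, one_pos, fun lam hlam b => ?_⟩
  have hρ : lam ^ ε ≤ lam ^ (1 / 3 : ℝ) := Real.rpow_le_rpow_of_exponent_le hlam hε
  let R : ℝ × ℝ → ℝ × ℝ → Prop := fun z w => (0 < Del lam z ∧ Del lam z ≤ √lam) ∧
    (0 < Del lam w ∧ Del lam w ≤ √lam) ∧ e2 (z - w) < lam ^ ε
  have hcard (z : ℝ × ℝ) : (((Zmed lam).filter (R z)).card : ℝ) ≤ 81 * 162 * Bmax lam := by
    have h := card_medians_le hlam hρ z (Finset.filter_subset (R z) (Zmed lam)) fun w hw =>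
      ⟨(Finset.mem_filter.mp hw).2.2.1.2, (Finset.mem_filter.mp hw).2.2.2⟩
    calc _ ≤ ((81 * Bmax lam * 162 : ℕ) : ℝ) := by exact_mod_cast h
      _ = _ := by push_cast; ring
  unfold pairSum
  convert sum_filter_mul_le_of_card_le (Zmed lam) R
    (fun z w h => ⟨h.2.1, h.1, e2_sub_comm z w ▸ h.2.2⟩) (fun z => ‖b z‖)
    (fun p => √(max 1 (e2 (p.1 - p.2)))) (fun _ => norm_nonneg _)
    (fun p => Real.one_le_sqrt.mpr (le_max_left _ _)) hcard
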